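/- Effect of removing a bidirected edge on the covariance matrix: with P = (1 − Λ)⁻¹, the following identities hold. (i) Σ⋆ a a' = Σ a a' for all a, a' ∈ nd(b); (ii) Σ⋆ a b = Σ a b − (P a⋆ a) · ω for all a ∈ nd(b); (iii) Σ⋆ b b = Σ b b − 2 ω · (P a⋆ b); (iv) Σ⋆ a c = Σ a c − ω · (P a⋆ a) · (P b c) for all a ∈ nd(b) and c ∈ de(b), c ≠ b; (v) Σ⋆ b c = Σ b c − ω · (P a⋆ c) − ω · (P a⋆ b) · (P b c) for all c ∈ de(b), c ≠ b; (vi) Σ⋆ c c' = Σ c c' − ω · (P a⋆ c) · (P b c') − ω · (P a⋆ c') · (P b c) for all c, c' ∈ de(b) with c ≠ b, c' ≠ b. -/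

import Mathlib

open Matrix

attribute [local instance] Classical.propDecidable

namespace EdgeIntervention

variable {n : ℕ}

/-- Descendants of `b` (including `b`): vertices reachable under the edge relation of `D`. -/
def desc (D : Set (Fin n × Fin n)) (b : Fin n) : Set (Fin n) :=
  {c | Relation.ReflTransGen (fun i j => (i, j) ∈ D) b c}

/-- Ancestors of `c` (including `c`). -/
def anc (D : Set (Fin n × Fin n)) (c : Fin n) : Set (Fin n) :=
  {i | c ∈ desc D i}

/-- Descendants of `b` in the induced subgraph on `W`. -/
def descW (D : Set (Fin n × Fin n)) (W : Set (Fin n)) (b : Fin n) : Set (Fin n) :=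
  {c | Relation.ReflTransGen (fun i j => (i, j) ∈ D ∧ i ∈ W ∧ j ∈ W) b c}

/-- District of `b` in the induced subgraph on `W`. -/
def disW (B : Set (Fin n × Fin n)) (W : Set (Fin n)) (b : Fin n) : Set (Fin n) :=
  {c | Relation.ReflTransGen (fun i j => (i, j) ∈ B ∧ i ∈ W ∧ j ∈ W) b c}

/-- Markov blanket of `b` in the induced subgraph on `W`. -/
def mbW (D B : Set (Fin n × Fin n)) (W : Set (Fin n)) (b : Fin n) : Set (Fin n) :=
  (disW B W b ∪ {i | i ∈ W ∧ ∃ d ∈ disW B W b, (i, d) ∈ D}) \ {b}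

/-- `Λ` is supported on the directed edge set `D`. -/
def DSupported (D : Set (Fin n × Fin n)) (Λ : Matrix (Fin n) (Fin n) ℝ) : Prop :=
  ∀ i j, (i, j) ∉ D → Λ i j = 0

/-- `Ω` is compatible with the bidirected edge set `B`: symmetric, positive definite,
and vanishing off the diagonal and off `B`. -/
def BCompatible (B : Set (Fin n × Fin n)) (Ω : Matrix (Fin n) (Fin n) ℝ) : Prop :=
  Ω.IsSymm ∧ Ω.PosDef ∧ ∀ i j, i ≠ j → (i, j) ∉ B → Ω i j = 0

/-- The covariance matrix `Σ = ((1 - Λ)⁻¹)ᵀ * Ω * (1 - Λ)⁻¹` of the linear SEM. -/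
noncomputable def cov (Λ Ω : Matrix (Fin n) (Fin n) ℝ) : Matrix (Fin n) (Fin n) ℝ :=
  ((1 - Λ)⁻¹)ᵀ * Ω * (1 - Λ)⁻¹

/-- Sum over all directed paths from `i` to `j` of their weights.  A path with `k` edges is
encoded as `f : Fin (k+1) → Fin n` with all steps in `D`; since edges strictly increase,
every directed path has at most `n` edges, so `k` ranges over `Finset.range (n+1)`. -/
noncomputable def pathSum (D : Set (Fin n × Fin n)) (Λ : Matrix (Fin n) (Fin n) ℝ)
    (i j : Fin n) : ℝ :=
  ∑ k ∈ Finset.range (n + 1),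
    ∑ f ∈ Finset.univ.filter
        (fun f : Fin (k + 1) → Fin n =>
          f 0 = i ∧ f (Fin.last k) = j ∧ ∀ t : Fin k, (f t.castSucc, f t.succ) ∈ D),
      ∏ t : Fin k, Λ (f t.castSucc) (f t.succ)

/-- Conditional covariance `σ_{vw·S} = Σ v w − Σ_{vS} (Σ_{SS})⁻¹ Σ_{Sw}`. -/
noncomputable def condCov (Cov : Matrix (Fin n) (Fin n) ℝ) (S : Set (Fin n))
    (v w : Fin n) : ℝ :=
  letI := (Set.toFinite S).fintype
  Cov v w - ∑ i : S, ∑ j : S,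
    Cov v i.val * (Cov.submatrix (Subtype.val : S → Fin n) Subtype.val)⁻¹ i j * Cov j.val w

/-- Regression coefficient `β_{vw·S} = σ_{vw·S} / σ_{vv·S}`. -/
noncomputable def regCoef (Cov : Matrix (Fin n) (Fin n) ℝ) (S : Set (Fin n))
    (v w : Fin n) : ℝ :=
  condCov Cov S v w / condCov Cov S v v

/-- The matrix obtained from `Λ` by setting the `(a,b)` entry to `0`
(removal of the directed edge `a → b`). -/
def removeEdge (Λ : Matrix (Fin n) (Fin n) ℝ) (a b : Fin n) : Matrix (Fin n) (Fin n) ℝ :=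
  Matrix.of fun i j => if i = a ∧ j = b then 0 else Λ i j

/-- The matrix obtained from `Ω` by setting the `(a,b)` and `(b,a)` entries to `0`
(removal of the bidirected edge `a ↔ b`). -/
def removeBi (Ω : Matrix (Fin n) (Fin n) ℝ) (a b : Fin n) : Matrix (Fin n) (Fin n) ℝ :=
  Matrix.of fun i j => if (i = a ∧ j = b) ∨ (i = b ∧ j = a) then 0 else Ω i j

/-- Descendants of `b` are not smaller than `b` when all edges are increasing. -/
lemma le_of_mem_desc {D : Set (Fin n × Fin n)} (hD : ∀ i j : Fin n, (i, j) ∈ D → i < j)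
    {b c : Fin n} (h : c ∈ desc D b) : b ≤ c := by
  induction h with
  | refl => exact le_rfl
  | tail _ hjk ih => exact ih.trans (hD _ _ hjk).le

lemma isUnit_det_one_sub {D : Set (Fin n × Fin n)} (hD : ∀ i j : Fin n, (i, j) ∈ D → i < j)
    {Λ : Matrix (Fin n) (Fin n) ℝ} (hΛ : DSupported D Λ) : IsUnit (1 - Λ).det := by
  have hzero : ∀ i j : Fin n, j ≤ i → Λ i j = 0 := fun i j hji =>
    hΛ i j fun h => (hD i j h).not_ge hji
  have htri : (1 - Λ).IsUpperTriangular := fun i j (hji : j < i) => by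
    simp [hzero i j hji.le, Matrix.one_apply_ne hji.ne']
  rw [Matrix.det_of_isUpperTriangular htri]
  simp [hzero _ _ le_rfl]

/-- The entrywise form of `P * (1 - Λ) = 1` for `P = (1 - Λ)⁻¹`. -/
lemma inv_one_sub_apply {D : Set (Fin n × Fin n)} (hD : ∀ i j : Fin n, (i, j) ∈ D → i < j)
    {Λ : Matrix (Fin n) (Fin n) ℝ} (hΛ : DSupported D Λ) (i j : Fin n) :
    (1 - Λ)⁻¹ i j = (1 : Matrix (Fin n) (Fin n) ℝ) i j + ∑ k, (1 - Λ)⁻¹ i k * Λ k j := by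
  have h := Matrix.nonsing_inv_mul (1 - Λ) (isUnit_det_one_sub hD hΛ)
  rw [Matrix.mul_sub, Matrix.mul_one, sub_eq_iff_eq_add] at h
  exact congrFun (congrFun h i) j

lemma inv_one_sub_apply_of_notMem_desc {D : Set (Fin n × Fin n)}
    (hD : ∀ i j : Fin n, (i, j) ∈ D → i < j)
    {Λ : Matrix (Fin n) (Fin n) ℝ} (hΛ : DSupported D Λ) {b : Fin n} (j : Fin n)
    (hj : j ∉ desc D b) : (1 - Λ)⁻¹ b j = 0 := by
  induction j using WellFoundedLT.induction with
  | ind j ih =>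
    have hbj : b ≠ j := fun h => hj (h ▸ Relation.ReflTransGen.refl)
    rw [inv_one_sub_apply hD hΛ, Matrix.one_apply_ne hbj, zero_add]
    refine Finset.sum_eq_zero fun k _ => ?_
    by_cases hkj : (k, j) ∈ D
    · rw [ih k (hD k j hkj) fun hk => hj (Relation.ReflTransGen.tail hk hkj), zero_mul]
    · rw [hΛ k j hkj, mul_zero]

lemma inv_one_sub_apply_self {D : Set (Fin n × Fin n)}
    (hD : ∀ i j : Fin n, (i, j) ∈ D → i < j)
    {Λ : Matrix (Fin n) (Fin n) ℝ} (hΛ : DSupported D Λ) (b : Fin n) :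
    (1 - Λ)⁻¹ b b = 1 := by
  rw [inv_one_sub_apply hD hΛ, Matrix.one_apply_eq, add_eq_left]
  refine Finset.sum_eq_zero fun k _ => ?_
  by_cases hkb : (k, b) ∈ D
  · rw [inv_one_sub_apply_of_notMem_desc hD hΛ k fun hk =>
      (hD k b hkb).not_ge (le_of_mem_desc hD hk), zero_mul]
  · rw [hΛ k b hkb, mul_zero]

lemma removeBi_eq_sub {Ω : Matrix (Fin n) (Fin n) ℝ} (hΩ : Ω.IsSymm) {a b : Fin n}
    (hab : a ≠ b) :
    removeBi Ω a b = Ω - (Matrix.single a b (Ω a b) + Matrix.single b a (Ω a b)) := by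
  ext i j
  have hba := hΩ.apply a b
  simp only [removeBi, Matrix.of_apply, Matrix.sub_apply, Matrix.add_apply, Matrix.single_apply]
  grind

/-- Removing the bidirected edge `a ↔ b` changes the covariance matrix by a symmetric
matrix of rank at most two. -/
lemma cov_removeBi_apply (Λ : Matrix (Fin n) (Fin n) ℝ) {Ω : Matrix (Fin n) (Fin n) ℝ}
    (hΩ : Ω.IsSymm) {a b : Fin n} (hab : a ≠ b) (x y : Fin n) :
    cov Λ (removeBi Ω a b) x y = cov Λ Ω x y
      - Ω a b * ((1 - Λ)⁻¹ a x * (1 - Λ)⁻¹ b y + (1 - Λ)⁻¹ b x * (1 - Λ)⁻¹ a y) := by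
  have hsingle (i j : Fin n) (w : ℝ) (P : Matrix (Fin n) (Fin n) ℝ) :
      (Pᵀ * Matrix.single i j w * P) x y = w * (P i x * P j y) := by
    rw [Matrix.mul_apply, Finset.sum_eq_single j]
    · rw [Matrix.mul_single_apply_same, Matrix.transpose_apply]
      ring
    · intro k _ hk
      rw [Matrix.mul_single_apply_of_ne _ _ _ _ _ hk, zero_mul]
    · simp
  simp only [cov, removeBi_eq_sub hΩ hab, Matrix.mul_sub, Matrix.sub_mul, Matrix.mul_add,
    Matrix.add_mul, Matrix.sub_apply, Matrix.add_apply, hsingle]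
  ring

/-- effect of removing the bidirected edge `a⋆ ↔ b` on the covariance matrix,
where `ω = Ω a⋆ b`, `Σ⋆ = Pᵀ * Ω⋆ * P` and `P = (1 − Λ)⁻¹`. -/
theorem remove_bi_edge_cov (n : ℕ) (D B : Set (Fin n × Fin n))
    (hD : ∀ i j : Fin n, (i, j) ∈ D → i < j)
    (hBsymm : ∀ i j : Fin n, (i, j) ∈ B → (j, i) ∈ B)
    (hBirr : ∀ i : Fin n, (i, i) ∉ B)
    (Λ Ω : Matrix (Fin n) (Fin n) ℝ)
    (hΛ : DSupported D Λ) (hΩ : BCompatible B Ω)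
    (astar b : Fin n) (hab : (astar, b) ∈ B) (hnd : astar ∉ desc D b) :
    (∀ a a' : Fin n, a ∉ desc D b → a' ∉ desc D b →
      cov Λ (removeBi Ω astar b) a a' = cov Λ Ω a a') ∧
    (∀ a : Fin n, a ∉ desc D b →
      cov Λ (removeBi Ω astar b) a b
        = cov Λ Ω a b - (1 - Λ)⁻¹ astar a * Ω astar b) ∧
    (cov Λ (removeBi Ω astar b) b b
      = cov Λ Ω b b - 2 * Ω astar b * (1 - Λ)⁻¹ astar b) ∧
    (∀ a c : Fin n, a ∉ desc D b → c ∈ desc D b → c ≠ b →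
      cov Λ (removeBi Ω astar b) a c
        = cov Λ Ω a c - Ω astar b * (1 - Λ)⁻¹ astar a * (1 - Λ)⁻¹ b c) ∧
    (∀ c : Fin n, c ∈ desc D b → c ≠ b →
      cov Λ (removeBi Ω astar b) b c
        = cov Λ Ω b c - Ω astar b * (1 - Λ)⁻¹ astar c
          - Ω astar b * (1 - Λ)⁻¹ astar b * (1 - Λ)⁻¹ b c) ∧
    (∀ c c' : Fin n, c ∈ desc D b → c ≠ b → c' ∈ desc D b → c' ≠ b →
      cov Λ (removeBi Ω astar b) c c'
        = cov Λ Ω c c' - Ω astar b * (1 - Λ)⁻¹ astar c * (1 - Λ)⁻¹ b c'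
          - Ω astar b * (1 - Λ)⁻¹ astar c' * (1 - Λ)⁻¹ b c) := by
  have hne : astar ≠ b := fun h => hBirr b (h ▸ hab)
  have key := cov_removeBi_apply Λ hΩ.1 hne
  have hb := inv_one_sub_apply_self hD hΛ b
  have hz := inv_one_sub_apply_of_notMem_desc hD hΛ (b := b)
  refine ⟨fun a a' ha ha' => ?_, fun a ha => ?_, ?_, fun a c ha _ _ => ?_, fun c _ _ => ?_,
    fun c c' _ _ _ _ => ?_⟩
  · rw [key, hz a ha, hz a' ha']; ring
  · rw [key, hz a ha, hb]; ring
  · rw [key, hb]; ring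
  · rw [key, hz a ha]; ring
  · rw [key, hb]; ring
  · rw [key]; ring

end EdgeIntervention
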